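/- Assume char k ≠ 2. Let A = R/I be a standard graded algebra with Hilbert function h, let d ≥ 1 and let m be a positive integer with m ≤ r − 1. Suppose that h_d = C(m+d, d), that for a general linear form L one has dim_k (R/(I + (L)))_d = C(m−1+d, d), and that the socle of A is zero in all degrees ≤ d−1 (for instance, A is artinian level of socle degree ≥ d). Then h_i = C(m+i, i) for every 0 ≤ i ≤ d; in particular h = (1, m+1, C(m+2,2), …, C(m+d,d)) up to degree d. -/

import Mathlib

open MvPolynomial

/-- The degree-`d` graded component of `R/I` (the image of the space of
degree-`d` homogeneous polynomials in the quotient), as a `k`-submodule. -/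
noncomputable def gradedPiece (k : Type*) [Field k] (r : ℕ)
    (I : Ideal (MvPolynomial (Fin r) k)) (d : ℕ) :
    Submodule k (MvPolynomial (Fin r) k ⧸ I) :=
  Submodule.map (Ideal.Quotient.mkₐ k I).toLinearMap
    (homogeneousSubmodule (Fin r) k d)

/-- The Hilbert function of `R/I` in degree `d`. -/
noncomputable def hilb (k : Type*) [Field k] (r : ℕ)
    (I : Ideal (MvPolynomial (Fin r) k)) (d : ℕ) : ℕ :=
  Module.finrank k (gradedPiece k r I d)

/-- `I` is a homogeneous ideal. -/
def IsHomogIdeal {k : Type*} [Field k] {r : ℕ}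
    (I : Ideal (MvPolynomial (Fin r) k)) : Prop :=
  ∀ f ∈ I, ∀ n : ℕ, homogeneousComponent n f ∈ I

/-- `I` contains no nonzero linear forms. -/
def NoLinearForms {k : Type*} [Field k] {r : ℕ}
    (I : Ideal (MvPolynomial (Fin r) k)) : Prop :=
  ∀ f ∈ I, f.IsHomogeneous 1 → f = 0

/-- The dimension of the degree-`i` component of the socle of `R/I`. -/
noncomputable def socDim (k : Type*) [Field k] (r : ℕ)
    (I : Ideal (MvPolynomial (Fin r) k)) (i : ℕ) : ℕ :=
  Module.finrank k (Submodule.map (Ideal.Quotient.mkₐ k I).toLinearMap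
    (homogeneousSubmodule (Fin r) k i ⊓
      ⨅ j : Fin r, Submodule.comap (LinearMap.mulLeft k (X j))
        (Submodule.restrictScalars k I)))

/-- `R/I` is a standard graded artinian algebra:
`I` is homogeneous and `R/I` is finite-dimensional over `k`. -/
def StdArtinian (k : Type*) [Field k] (r : ℕ)
    (I : Ideal (MvPolynomial (Fin r) k)) : Prop :=
  IsHomogIdeal I ∧ Module.Finite k (MvPolynomial (Fin r) k ⧸ I)

/-- `R/I` has socle degree `e`: `e` is the largest degree with nonzero
Hilbert function. -/
def SocleDegree (k : Type*) [Field k] (r : ℕ)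
    (I : Ideal (MvPolynomial (Fin r) k)) (e : ℕ) : Prop :=
  hilb k r I e ≠ 0 ∧ ∀ j : ℕ, e < j → hilb k r I j = 0

/-- `R/I` is a standard graded artinian Gorenstein algebra of socle degree `e`:
the socle vanishes below degree `e` and is one-dimensional in degree `e`. -/
def Gorenstein (k : Type*) [Field k] (r e : ℕ)
    (I : Ideal (MvPolynomial (Fin r) k)) : Prop :=
  StdArtinian k r I ∧ SocleDegree k r I e ∧
    (∀ i : ℕ, i < e → socDim k r I i = 0) ∧ socDim k r I e = 1

/-- `R/I` is a standard graded artinian level algebra of socle degree `e`. -/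
def LevelAlg (k : Type*) [Field k] (r e : ℕ)
    (I : Ideal (MvPolynomial (Fin r) k)) : Prop :=
  StdArtinian k r I ∧ SocleDegree k r I e ∧
    (∀ i : ℕ, i < e → socDim k r I i = 0)

/-- The linear form with coefficient vector `c`. -/
noncomputable def linForm {k : Type*} [Field k] {r : ℕ} (c : Fin r → k) :
    MvPolynomial (Fin r) k :=
  ∑ i, C (c i) * X i

/-- A property `P` holds for a general linear form: there is a nonempty
(basic) Zariski-open subset of the space of linear forms on which `P` holds. -/
def Generically (k : Type*) [Field k] (r : ℕ)
    (P : MvPolynomial (Fin r) k → Prop) : Prop :=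
  ∃ Q : MvPolynomial (Fin r) k, Q ≠ 0 ∧
    ∀ c : Fin r → k, eval c Q ≠ 0 → P (linForm c)

/-- `R/I` has the weak Lefschetz property (socle degree `e`): multiplication
by some linear form has maximal rank from each degree `i < e` to degree `i+1`. -/
def WLP (k : Type*) [Field k] (r e : ℕ)
    (I : Ideal (MvPolynomial (Fin r) k)) : Prop :=
  ∃ L : MvPolynomial (Fin r) k, L.IsHomogeneous 1 ∧
    ∀ i : ℕ, i < e →
      Module.finrank k (Submodule.map
        (LinearMap.mulLeft k (Ideal.Quotient.mk I L)) (gradedPiece k r I i)) =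
      min (hilb k r I i) (hilb k r I (i + 1))

/-- The largest `t` with `choose t i ≤ n`: the leading top in the
`i`-binomial expansion of `n`. -/
noncomputable def binTop (n i : ℕ) : ℕ := sSup {t : ℕ | Nat.choose t i ≤ n}

/-- Auxiliary recursion computing `((n)_{(i)})⁻¹₀`, i.e. the sum
`C(n_i - 1, i) + C(n_{i-1} - 1, i-1) + ⋯ + C(n_j - 1, j)` where
`n_{(i)} = C(n_i, i) + ⋯ + C(n_j, j)` is the `i`-binomial expansion of `n`. -/
noncomputable def greenBoundAux : ℕ → ℕ → ℕ
  | 0, _ => 0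
  | (i + 1), n =>
    if n = 0 then 0 else
      Nat.choose (binTop n (i + 1) - 1) (i + 1) +
        greenBoundAux i (n - Nat.choose (binTop n (i + 1)) (i + 1))

/-- `greenBound n i = ((n)_{(i)})⁻¹₀`. -/
noncomputable def greenBound (n i : ℕ) : ℕ := greenBoundAux i n

/-- The filter of properties that hold on a nonempty basic Zariski-open set. -/
def zariskiGeneric (k : Type*) [Field k] (r : ℕ) : Filter (Fin r → k) where
  sets := {s | ∃ Q : MvPolynomial (Fin r) k, Q ≠ 0 ∧ ∀ c, eval c Q ≠ 0 → c ∈ s}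
  univ_sets := ⟨1, one_ne_zero, fun _ _ => trivial⟩
  sets_of_superset := fun ⟨Q, hQ, h⟩ hst => ⟨Q, hQ, fun c hc => hst (h c hc)⟩
  inter_sets := fun ⟨P, hP, h⟩ ⟨Q, hQ, h'⟩ => ⟨P * Q, mul_ne_zero hP hQ, fun c hc => by
    rw [map_mul] at hc
    exact ⟨h c (left_ne_zero_of_mul hc), h' c (right_ne_zero_of_mul hc)⟩⟩

section Generic

variable {k : Type*} [Field k] {r : ℕ}

lemma eventually_zariskiGeneric {P : (Fin r → k) → Prop} :
    (∀ᶠ c in zariskiGeneric k r, P c) ↔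
      ∃ Q : MvPolynomial (Fin r) k, Q ≠ 0 ∧ ∀ c, eval c Q ≠ 0 → P c :=
  Iff.rfl

lemma eventually_zariskiGeneric_of_eval_ne_zero {P : (Fin r → k) → Prop}
    (Q : MvPolynomial (Fin r) k) {c₀ : Fin r → k} (h₀ : eval c₀ Q ≠ 0)
    (h : ∀ c, eval c Q ≠ 0 → P c) : ∀ᶠ c in zariskiGeneric k r, P c :=
  ⟨Q, by rintro rfl; simp at h₀, h⟩

lemma exists_eval_add_smul_ne_zero [Infinite k] (Q : MvPolynomial (Fin r) k) {c₀ : Fin r → k}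
    (h₀ : eval c₀ Q ≠ 0) (e : Fin r → k) : ∃ t : k, t ≠ 0 ∧ eval (c₀ + t • e) Q ≠ 0 := by
  set P : Polynomial k :=
    aeval (fun i => Polynomial.C (c₀ i) + Polynomial.X * Polynomial.C (e i)) Q with hP
  have hev : ∀ t, P.eval t = eval (c₀ + t • e) Q := by
    intro t
    have : (Polynomial.evalRingHom t).comp (aeval fun i => Polynomial.C (c₀ i) +
        Polynomial.X * Polynomial.C (e i)).toRingHom = eval (c₀ + t • e) :=
      ringHom_ext (by simp) fun i => by simp [mul_comm t]
    exact RingHom.congr_fun this Q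
  by_contra! hcon
  have : Polynomial.X * P = 0 := Polynomial.funext fun t => by
    by_cases ht : t = 0
    · simp [ht]
    · simp [hev, hcon t ht]
  rcases mul_eq_zero.1 this with h | h
  · exact Polynomial.X_ne_zero h
  · apply h₀
    have := hev 0
    rw [h] at this
    simpa using this.symm

instance zariskiGeneric_neBot [Infinite k] : (zariskiGeneric k r).NeBot := by
  rw [Filter.neBot_iff]
  intro h
  obtain ⟨Q, hQ, hc⟩ := eventually_zariskiGeneric.1 (Filter.empty_mem_iff_bot.2 h)
  exact hQ (MvPolynomial.funext fun c => by
    rw [map_zero]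
    exact by_contra fun h => hc c h)

lemma Submodule.eq_top_of_eventually_zariskiGeneric [Infinite k] {P : Submodule k (Fin r → k)}
    (h : ∀ᶠ c in zariskiGeneric k r, c ∈ P) : P = ⊤ := by
  obtain ⟨Q, hQ, hP⟩ := h
  obtain ⟨c₀, h₀⟩ : ∃ c₀, eval c₀ Q ≠ 0 := by
    by_contra! hcon
    exact hQ (MvPolynomial.funext fun c => by simpa using hcon c)
  rw [eq_top_iff]
  intro e _
  obtain ⟨t, ht, hte⟩ := exists_eval_add_smul_ne_zero Q h₀ e
  have := P.sub_mem (hP _ hte) (hP _ h₀)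
  rw [add_sub_cancel_left] at this
  exact (P.smul_mem_iff ht).1 this

lemma linForm_dual_eval (l : (Fin r → k) →ₗ[k] k) :
    ∃ P : MvPolynomial (Fin r) k, ∀ c, l c = eval c P := by
  refine ⟨linForm fun i => l (Pi.single i 1), fun c => ?_⟩
  rw [LinearMap.pi_apply_eq_sum_univ l c]
  simp [linForm, mul_comm]
  refine Finset.sum_congr rfl fun i _ => ?_
  congr 2
  ext j; simp [Pi.single_apply, eq_comm]

lemma Submodule.eventually_notMem {P : Submodule k (Fin r → k)} (h : P ≠ ⊤) :
    ∀ᶠ c in zariskiGeneric k r, c ∉ P := by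
  obtain ⟨c₀, -, h₀⟩ := SetLike.exists_of_lt (lt_top_iff_ne_top.2 h)
  obtain ⟨f, hf, hP⟩ := Submodule.exists_le_ker_of_notMem h₀
  obtain ⟨Q, hQ⟩ := linForm_dual_eval f
  exact eventually_zariskiGeneric_of_eval_ne_zero Q (c₀ := c₀) (by rwa [← hQ])
    fun c hc hcP => hc (by rw [← hQ]; exact hP hcP)

lemma exists_eval_ne_zero_forall_linearIndependent {ι X : Type*} [Fintype ι] [AddCommGroup X]
    [Module k X] (v : (Fin r → k) → ι → X)
    (hv : ∀ (f : X →ₗ[k] k) (j : ι), ∃ P : MvPolynomial (Fin r) k, ∀ c, f (v c j) = eval c P)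
    {c₀ : Fin r → k} (h₀ : LinearIndependent k (v c₀)) :
    ∃ Q : MvPolynomial (Fin r) k, eval c₀ Q ≠ 0 ∧
      ∀ c, eval c Q ≠ 0 → LinearIndependent k (v c) := by
  classical
  obtain ⟨f, hf⟩ := (Fintype.linearCombination k (v c₀)).exists_leftInverse_of_injective
    (LinearMap.ker_eq_bot.2 (h₀.fintypeLinearCombination_injective))
  choose P hP using fun i j => hv (LinearMap.proj i ∘ₗ f) j
  have hdet : ∀ c, eval c (Matrix.of P).det = (Matrix.of fun i j => f (v c j) i).det := by
    intro c
    rw [RingHom.map_det]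
    congr 1
    ext i j
    simp [← hP]
  refine ⟨(Matrix.of P).det, ?_, fun c hc => ?_⟩
  · rw [hdet]
    have : (Matrix.of fun i j => f (v c₀ j) i) = 1 := by
      ext i j
      have := LinearMap.congr_fun hf (Pi.single j 1)
      simp [Fintype.linearCombination_apply_single] at this
      simp [this, Matrix.one_apply, Pi.single_apply]
    simp [this]
  · rw [hdet] at hc
    exact LinearIndependent.of_comp f (Matrix.linearIndependent_cols_of_det_ne_zero hc)

section Rank

variable {V X : Type*} [AddCommGroup V] [Module k V] [AddCommGroup X] [Module k X]
  [FiniteDimensional k V] (T : (Fin r → k) →ₗ[k] V →ₗ[k] X)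

lemma exists_linearIndependent_range (g : V →ₗ[k] X) :
    ∃ v : Fin (Module.finrank k (LinearMap.range g)) → V, LinearIndependent k (g ∘ v) := by
  let b := Module.finBasis k (LinearMap.range g)
  choose v hv using fun i => (b i).2
  refine ⟨v, ?_⟩
  have := b.linearIndependent.map' (LinearMap.range g).subtype (Submodule.ker_subtype _)
  rwa [show g ∘ v = (LinearMap.range g).subtype ∘ b from funext hv]

lemma eventually_forall_finrank_range_le :
    ∀ᶠ c in zariskiGeneric k r, ∀ c',
      Module.finrank k (LinearMap.range (T c')) ≤ Module.finrank k (LinearMap.range (T c)) := by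
  obtain ⟨c₀, h₀⟩ : ∃ c₀, ∀ c',
      Module.finrank k (LinearMap.range (T c')) ≤ Module.finrank k (LinearMap.range (T c₀)) := by
    have hb : BddAbove (Set.range fun c => Module.finrank k (LinearMap.range (T c))) :=
      ⟨Module.finrank k V, by rintro _ ⟨c, rfl⟩; exact LinearMap.finrank_range_le _⟩
    obtain ⟨c₀, hc₀⟩ := Nat.sSup_mem (Set.range_nonempty _) hb
    exact ⟨c₀, fun c' => (le_csSup hb ⟨c', rfl⟩).trans hc₀.ge⟩
  obtain ⟨v, hv⟩ := exists_linearIndependent_range (T c₀)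
  obtain ⟨Q, hQ₀, hQ⟩ := exists_eval_ne_zero_forall_linearIndependent (fun c j => T c (v j))
    (fun f j => linForm_dual_eval (f ∘ₗ T.flip (v j))) hv
  refine eventually_zariskiGeneric_of_eval_ne_zero Q hQ₀ fun c hc c' => (h₀ c').trans ?_
  have h1 : LinearIndependent k (fun j => (⟨T c (v j), LinearMap.mem_range_self _ _⟩ :
      LinearMap.range (T c))) :=
    LinearIndependent.of_comp (LinearMap.range (T c)).subtype (hQ c hc)
  simpa using h1.fintype_card_le_finrank

lemma apply_mem_range_of_forall_finrank_range_le [Infinite k] {c : Fin r → k}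
    (hc : ∀ c', Module.finrank k (LinearMap.range (T c')) ≤
      Module.finrank k (LinearMap.range (T c)))
    {f : V} (hf : T c f = 0) (e : Fin r → k) : T e f ∈ LinearMap.range (T c) := by
  by_contra hcon
  obtain ⟨v, hv⟩ := exists_linearIndependent_range (T c)
  have hind : LinearIndependent k (fun j : Option _ => j.casesOn' (T e f) (T c ∘ v)) :=
    hv.option fun h => hcon <| Submodule.span_le.2 (by
      rintro _ ⟨i, rfl⟩; exact LinearMap.mem_range_self _ _) h
  obtain ⟨Q, hQ₀, hQ⟩ := exists_eval_ne_zero_forall_linearIndependent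
    (fun c (j : Option _) => j.casesOn' (T e f) (T c ∘ v))
    (fun g j => by
      cases j with
      | none => exact ⟨C (g (T e f)), fun c => by simp⟩
      | some j => exact linForm_dual_eval (g ∘ₗ T.flip (v j))) hind
  obtain ⟨t, ht, hte⟩ := exists_eval_add_smul_ne_zero Q hQ₀ e
  have hmem : ∀ j : Option _, j.casesOn' (T e f) (T (c + t • e) ∘ v) ∈
      LinearMap.range (T (c + t • e)) := by
    intro j
    cases j with
    | none =>
      refine ⟨t⁻¹ • f, ?_⟩
      simp [hf, ht]
    | some j => exact LinearMap.mem_range_self _ _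
  have h1 : LinearIndependent k (fun j => (⟨_, hmem j⟩ : LinearMap.range (T (c + t • e)))) :=
    LinearIndependent.of_comp (LinearMap.range (T (c + t • e))).subtype (hQ _ hte)
  have h2 := h1.fintype_card_le_finrank
  have h3 := hc (c + t • e)
  simp at h2
  omega

end Rank

end Generic

section Codim

variable {k : Type*} [Field k] {r : ℕ}

/-- If `g` is linear, then the rank-nullity theorem holds for its restriction to a subspace. -/
lemma Submodule.finrank_map_add_finrank_inf_ker {V X : Type*} [AddCommGroup V] [Module k V]
    [AddCommGroup X] [Module k X] (g : V →ₗ[k] X) (S : Submodule k V) [FiniteDimensional k S] :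
    Module.finrank k (S.map g) + Module.finrank k (S ⊓ LinearMap.ker g : Submodule k V) =
      Module.finrank k S := by
  rw [← LinearMap.finrank_range_add_finrank_ker (g.domRestrict S), LinearMap.range_domRestrict,
    LinearMap.ker_domRestrict]
  congr 1
  rw [← Submodule.map_comap_subtype]
  exact (Submodule.equivMapOfInjective _ S.injective_subtype _).finrank_eq.symm

/-- The linear form with given coefficients, as a linear map. -/
noncomputable def linFormHom (k : Type*) [Field k] (r : ℕ) :
    (Fin r → k) →ₗ[k] MvPolynomial (Fin r) k where
  toFun := linForm
  map_add' c c' := by simp [linForm, add_mul, Finset.sum_add_distrib]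
  map_smul' t c := by simp [linForm, Finset.smul_sum, smul_eq_C_mul, mul_assoc]

@[simp] lemma linFormHom_apply (c : Fin r → k) : linFormHom k r c = linForm c := rfl

lemma linForm_single (i : Fin r) : linForm (Pi.single i (1 : k)) = X i := by
  simp [linForm, Pi.single_apply, apply_ite C, ite_mul]

/-- The space of forms of degree `d`. -/
noncomputable abbrev forms (k : Type*) [Field k] (r d : ℕ) :
    Submodule k (MvPolynomial (Fin r) k) :=
  homogeneousSubmodule (Fin r) k d

instance (d : ℕ) : FiniteDimensional k (forms k r d) :=
  Module.Finite.iff_fg.2 (homogeneousSubmodule_fg (Fin r) k d)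

lemma linForm_mem (c : Fin r → k) : linForm c ∈ forms k r 1 :=
  (mem_homogeneousSubmodule _ _).2 <| IsHomogeneous.sum _ _ _ fun _ _ =>
    isHomogeneous_C_mul_X _ _

lemma range_linFormHom : LinearMap.range (linFormHom k r) = forms k r 1 := by
  apply le_antisymm
  · rintro _ ⟨c, rfl⟩
    exact linForm_mem c
  · rw [forms, homogeneousSubmodule_one_eq_span_X, Submodule.span_le]
    rintro _ ⟨i, rfl⟩
    exact ⟨_, linForm_single i⟩

lemma linForm_mul_mem {d : ℕ} (c : Fin r → k) {f : MvPolynomial (Fin r) k}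
    (hf : f ∈ forms k r d) : linForm c * f ∈ forms k r (d + 1) := by
  rw [add_comm]
  exact homogeneousSubmodule_mul 1 d (Submodule.mul_mem_mul (linForm_mem c) hf)

lemma forms_succ_le {d : ℕ} {W : Submodule k (MvPolynomial (Fin r) k)}
    (h : ∀ c, ∀ f ∈ forms k r d, linForm c * f ∈ W) : forms k r (d + 1) ≤ W := by
  rw [forms, ← homogeneousSubmodule_one_pow, pow_succ', homogeneousSubmodule_one_pow,
    ← forms, ← range_linFormHom, Submodule.mul_le]
  rintro _ ⟨c, rfl⟩ f hf
  exact h c f hf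

/-- The codimension of `W` in degree `d`. -/
noncomputable def codim (d : ℕ) (W : Submodule k (MvPolynomial (Fin r) k)) : ℕ :=
  Module.finrank k (forms k r d) - Module.finrank k (forms k r d ⊓ W : Submodule k _)

lemma codim_add (d : ℕ) (W : Submodule k (MvPolynomial (Fin r) k)) :
    codim d W + Module.finrank k (forms k r d ⊓ W : Submodule k _) =
      Module.finrank k (forms k r d) :=
  Nat.sub_add_cancel (Submodule.finrank_mono inf_le_left)

lemma codim_anti {d : ℕ} {W W' : Submodule k (MvPolynomial (Fin r) k)}
    (h : forms k r d ⊓ W ≤ W') : codim d W' ≤ codim d W := by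
  have h1 := Submodule.finrank_mono (le_inf inf_le_left h)
  have := codim_add d W
  have := codim_add d W'
  omega

lemma inf_le_of_codim_le {d : ℕ} {W W' : Submodule k (MvPolynomial (Fin r) k)}
    (h : forms k r d ⊓ W ≤ W') (hc : codim d W ≤ codim d W') : forms k r d ⊓ W' ≤ W := by
  have h1 : forms k r d ⊓ W = forms k r d ⊓ W' := by
    apply Submodule.eq_of_le_of_finrank_le (le_inf inf_le_left h)
    have := codim_add d W
    have := codim_add d W'
    omega
  exact h1.ge.trans inf_le_right

lemma codim_eq_zero {d : ℕ} {W : Submodule k (MvPolynomial (Fin r) k)}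
    (h : forms k r d ≤ W) : codim d W = 0 := by
  rw [codim, inf_eq_left.2 h, Nat.sub_self]

lemma codim_zero_le (W : Submodule k (MvPolynomial (Fin r) k)) : codim 0 W ≤ 1 := by
  refine (Nat.sub_le _ _).trans ?_
  rw [forms, homogeneousSubmodule_zero, Submodule.one_eq_span]
  exact (finrank_span_le_card _).trans (by simp)

/-- Adjoining the multiples of the linear form with coefficients `c` in degree `d`. -/
noncomputable def adjoinForm (W : Submodule k (MvPolynomial (Fin r) k)) (c : Fin r → k) :
    ℕ → Submodule k (MvPolynomial (Fin r) k)
  | 0 => W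
  | d + 1 => W ⊔ (forms k r d).map (LinearMap.mulLeft k (linForm c))

/-- The polynomials whose product with the linear form with coefficients `c` lies in `W`. -/
noncomputable def colonForm (W : Submodule k (MvPolynomial (Fin r) k)) (c : Fin r → k) :
    Submodule k (MvPolynomial (Fin r) k) :=
  W.comap (LinearMap.mulLeft k (linForm c))

@[simp] lemma mem_colonForm {W : Submodule k (MvPolynomial (Fin r) k)} {c : Fin r → k}
    {f : MvPolynomial (Fin r) k} : f ∈ colonForm W c ↔ linForm c * f ∈ W := Iff.rfl

lemma le_adjoinForm (W : Submodule k (MvPolynomial (Fin r) k)) (c : Fin r → k) (d : ℕ) :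
    W ≤ adjoinForm W c d := by
  cases d
  · exact le_rfl
  · exact le_sup_left

lemma linForm_mul_mem_adjoinForm (W : Submodule k (MvPolynomial (Fin r) k)) (c : Fin r → k)
    {d : ℕ} {f : MvPolynomial (Fin r) k} (hf : f ∈ forms k r d) :
    linForm c * f ∈ adjoinForm W c (d + 1) :=
  Submodule.mem_sup_right ⟨f, hf, rfl⟩

lemma adjoinForm_comm (W : Submodule k (MvPolynomial (Fin r) k)) (c c' : Fin r → k) (d : ℕ) :
    adjoinForm (adjoinForm W c d) c' d = adjoinForm (adjoinForm W c' d) c d := by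
  cases d
  · rfl
  · exact sup_right_comm _ _ _

lemma adjoinForm_colonForm_le (W : Submodule k (MvPolynomial (Fin r) k)) (c c' : Fin r → k)
    (d : ℕ) : adjoinForm (colonForm W c) c' d ≤ colonForm (adjoinForm W c' (d + 1)) c := by
  have h : colonForm W c ≤ colonForm (adjoinForm W c' (d + 1)) c :=
    Submodule.comap_mono (le_adjoinForm _ _ _)
  cases d with
  | zero => exact h
  | succ d =>
    refine sup_le h ?_
    rintro _ ⟨f, hf, rfl⟩
    rw [mem_colonForm, LinearMap.mulLeft_apply, mul_left_comm]
    exact linForm_mul_mem_adjoinForm _ _ (linForm_mul_mem c hf)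

/-- Multiplication of forms of degree `d` by linear forms, modulo `W`. -/
noncomputable def mulModHom (W : Submodule k (MvPolynomial (Fin r) k)) (d : ℕ) :
    (Fin r → k) →ₗ[k] forms k r d →ₗ[k] MvPolynomial (Fin r) k ⧸ W :=
  LinearMap.mk₂ k (fun c f => W.mkQ (linForm c * f))
    (fun c c' f => by rw [← linFormHom_apply, map_add, add_mul, map_add]; rfl)
    (fun t c f => by rw [← linFormHom_apply, map_smul, smul_mul_assoc, map_smul]; rfl)
    (fun c f f' => by rw [Submodule.coe_add, mul_add, map_add])
    (fun t c f => by rw [Submodule.coe_smul, mul_smul_comm, map_smul])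

@[simp] lemma mulModHom_apply (W : Submodule k (MvPolynomial (Fin r) k)) (d : ℕ) (c : Fin r → k)
    (f : forms k r d) : mulModHom W d c f = W.mkQ (linForm c * f) := rfl

lemma range_mulModHom (W : Submodule k (MvPolynomial (Fin r) k)) (d : ℕ) (c : Fin r → k) :
    LinearMap.range (mulModHom W d c) =
      (forms k r d).map (W.mkQ ∘ₗ LinearMap.mulLeft k (linForm c)) := by
  ext x
  simp

lemma finrank_range_mulModHom (W : Submodule k (MvPolynomial (Fin r) k)) (d : ℕ)
    (c : Fin r → k) :
    Module.finrank k (LinearMap.range (mulModHom W d c)) = codim d (colonForm W c) := by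
  have h := Submodule.finrank_map_add_finrank_inf_ker
    (W.mkQ ∘ₗ LinearMap.mulLeft k (linForm c)) (forms k r d)
  rw [LinearMap.ker_comp, Submodule.ker_mkQ, ← range_mulModHom] at h
  have := codim_add d (colonForm W c)
  rw [colonForm] at this ⊢
  omega

lemma codim_succ_eq (W : Submodule k (MvPolynomial (Fin r) k)) (d : ℕ) (c : Fin r → k) :
    codim (d + 1) W = codim (d + 1) (adjoinForm W c (d + 1)) + codim d (colonForm W c) := by
  set M := (forms k r d).map (LinearMap.mulLeft k (linForm c)) with hM
  have hle : M ≤ forms k r (d + 1) := by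
    rintro _ ⟨f, hf, rfl⟩
    exact linForm_mul_mem c hf
  have h1 := Submodule.finrank_map_add_finrank_inf_ker W.mkQ M
  rw [Submodule.ker_mkQ, hM, ← Submodule.map_comp, ← range_mulModHom, finrank_range_mulModHom,
    ← hM] at h1
  have h2 := Submodule.finrank_sup_add_finrank_inf_eq (forms k r (d + 1) ⊓ W) M
  have h3 : forms k r (d + 1) ⊓ W ⊔ M = forms k r (d + 1) ⊓ adjoinForm W c (d + 1) := by
    rw [adjoinForm, ← hM, inf_sup_assoc_of_le _ hle]
  have h4 : forms k r (d + 1) ⊓ W ⊓ M = M ⊓ W := by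
    rw [inf_right_comm, inf_eq_right.2 hle]
  rw [h3, h4] at h2
  have h5 := codim_add (d + 1) W
  have h6 := codim_add (d + 1) (adjoinForm W c (d + 1))
  omega

lemma eventually_forall_codim_adjoinForm_le (W : Submodule k (MvPolynomial (Fin r) k)) (d : ℕ) :
    ∀ᶠ c in zariskiGeneric k r, ∀ c',
      codim d (adjoinForm W c d) ≤ codim d (adjoinForm W c' d) := by
  cases d with
  | zero => exact Filter.Eventually.of_forall fun _ _ => le_rfl
  | succ d =>
    filter_upwards [eventually_forall_finrank_range_le (mulModHom W d)] with c hc c'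
    have h := hc c'
    rw [finrank_range_mulModHom, finrank_range_mulModHom] at h
    have := codim_succ_eq W d c
    have := codim_succ_eq W d c'
    omega

lemma linForm_mul_mem_adjoinForm_of_forall_codim_le [Infinite k]
    {W : Submodule k (MvPolynomial (Fin r) k)} {d : ℕ} {c : Fin r → k}
    (hc : ∀ c', codim (d + 1) (adjoinForm W c (d + 1)) ≤ codim (d + 1) (adjoinForm W c' (d + 1)))
    {f : MvPolynomial (Fin r) k} (hf : f ∈ forms k r d) (hfW : linForm c * f ∈ W)
    (e : Fin r → k) : linForm e * f ∈ adjoinForm W c (d + 1) := by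
  have h := apply_mem_range_of_forall_finrank_range_le (mulModHom W d) (c := c)
    (fun c' => by
      rw [finrank_range_mulModHom, finrank_range_mulModHom]
      have := codim_succ_eq W d c
      have := codim_succ_eq W d c'
      have := hc c'
      omega) (f := ⟨f, hf⟩) (by simpa using hfW) e
  obtain ⟨g, hg⟩ := h
  have h1 : linForm e * f - linForm c * g ∈ W := by
    rw [← Submodule.Quotient.eq]
    exact hg.symm
  rw [← sub_add_cancel (linForm e * f) (linForm c * g)]
  exact add_mem (le_adjoinForm _ _ _ h1) (linForm_mul_mem_adjoinForm _ _ g.2)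

lemma eventually_codim_adjoinForm_lt [Infinite k] {W : Submodule k (MvPolynomial (Fin r) k)}
    {d : ℕ} (hW : codim (d + 1) W ≠ 0) :
    ∀ᶠ c in zariskiGeneric k r, codim (d + 1) (adjoinForm W c (d + 1)) < codim (d + 1) W := by
  obtain ⟨c₀, f, hf, hfW⟩ : ∃ c, ∃ f ∈ forms k r d, linForm c * f ∉ W := by
    by_contra! hcon
    exact hW (codim_eq_zero (forms_succ_le hcon))
  have hne : (W.comap (LinearMap.mulRight k f)).comap (linFormHom k r) ≠ ⊤ := fun h =>
    hfW (by simpa using h.ge (Submodule.mem_top (x := c₀)))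
  filter_upwards [Submodule.eventually_notMem hne] with c hc
  have h1 := codim_succ_eq W d c
  refine lt_of_le_of_ne (by omega) fun h2 => hc ?_
  have h3 : forms k r d ⊓ colonForm W c = forms k r d := by
    apply Submodule.eq_of_le_of_finrank_le inf_le_left
    have := codim_add d (colonForm W c)
    omega
  exact (h3.ge hf).2

end Codim

section RisingBinom

/-- The polynomial function `x (x + 1) ⋯ (x + d - 1) / d!`. -/
noncomputable def risingBinom : ℕ → ℝ → ℝ
  | 0, _ => 1
  | d + 1, x => risingBinom d x * ((x + d) / (d + 1))

lemma risingBinom_nonneg (d : ℕ) {x : ℝ} (hx : 0 ≤ x) : 0 ≤ risingBinom d x := by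
  induction d with
  | zero => simp [risingBinom]
  | succ d ih => exact mul_nonneg ih (by positivity)

lemma risingBinom_pos (d : ℕ) {x : ℝ} (hx : 0 < x) : 0 < risingBinom d x := by
  induction d with
  | zero => simp [risingBinom]
  | succ d ih => exact mul_pos ih (by positivity)

lemma risingBinom_one (d : ℕ) : risingBinom d 1 = 1 := by
  induction d with
  | zero => simp [risingBinom]
  | succ d ih => rw [risingBinom, ih]; field_simp; ring

lemma risingBinom_one_left (x : ℝ) : risingBinom 1 x = x := by
  simp [risingBinom]

lemma risingBinom_mono (d : ℕ) {x y : ℝ} (hx : 0 ≤ x) (hxy : x ≤ y) :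
    risingBinom d x ≤ risingBinom d y := by
  induction d with
  | zero => simp [risingBinom]
  | succ d ih =>
    exact mul_le_mul ih (by gcongr) (by positivity) (risingBinom_nonneg d (hx.trans hxy))

lemma risingBinom_strictMono (d : ℕ) {x y : ℝ} (hx : 0 ≤ x) (hxy : x < y) :
    risingBinom (d + 1) x < risingBinom (d + 1) y := by
  rw [risingBinom, risingBinom]
  refine mul_lt_mul' (risingBinom_mono d hx hxy.le) (by gcongr) (by positivity)
    (risingBinom_pos d (hx.trans_lt hxy))

lemma risingBinom_add_one_mul (d : ℕ) (x : ℝ) :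
    risingBinom d (x + 1) * x = risingBinom d x * (x + d) := by
  induction d with
  | zero => simp [risingBinom]
  | succ d ih =>
    rw [risingBinom, risingBinom, mul_right_comm, ih]
    push_cast
    ring

lemma risingBinom_pascal (d : ℕ) (x : ℝ) :
    risingBinom (d + 1) (x + 1) = risingBinom (d + 1) x + risingBinom d (x + 1) := by
  have h := risingBinom_add_one_mul d x
  rw [risingBinom, risingBinom, mul_div_assoc', mul_div_assoc', ← h]
  field_simp
  ring

lemma continuous_risingBinom (d : ℕ) : Continuous (risingBinom d) := by
  induction d with
  | zero => exact continuous_const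
  | succ d ih => exact ih.mul (by fun_prop)

lemma le_risingBinom (d : ℕ) {x : ℝ} (hx : 1 ≤ x) : x ≤ risingBinom (d + 1) x := by
  induction d with
  | zero => rw [zero_add, risingBinom_one_left]
  | succ d ih =>
    refine ih.trans (le_mul_of_one_le_right (risingBinom_nonneg _ (by linarith)) ?_)
    rw [one_le_div (by positivity)]
    linarith

lemma exists_risingBinom_eq (d : ℕ) {a : ℝ} (ha : 1 ≤ a) :
    ∃ y, 1 ≤ y ∧ risingBinom (d + 1) y = a := by
  obtain ⟨y, hy, h⟩ := intermediate_value_Icc ha (continuous_risingBinom (d + 1)).continuousOn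
    ⟨(risingBinom_one _).trans_le ha, le_risingBinom d ha⟩
  exact ⟨y, hy.1, h⟩

lemma risingBinom_natCast_add_one (d m : ℕ) :
    risingBinom d (m + 1) = Nat.choose (m + d) d := by
  induction d generalizing m with
  | zero => simp [risingBinom]
  | succ d ih =>
    induction m with
    | zero => simp [risingBinom_one]
    | succ m ihm =>
      rw [risingBinom_pascal, Nat.cast_succ, ihm, ← Nat.cast_succ, ih,
        show m + 1 + (d + 1) = (m + (d + 1)) + 1 by ring, Nat.choose_succ_succ', Nat.cast_add,
        add_comm, show m + 1 + d = m + (d + 1) by ring]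

end RisingBinom

section Green

variable {k : Type*} [Field k] [Infinite k] {r : ℕ}

/-- A form of Green's hyperplane restriction theorem. -/
theorem eventually_codim_adjoinForm_le_risingBinom (d : ℕ)
    (W : Submodule k (MvPolynomial (Fin r) k)) :
    ∀ᶠ c in zariskiGeneric k r,
      (∀ x : ℝ, 0 ≤ x → codim d W ≤ risingBinom d (x + 1) →
        codim d (adjoinForm W c d) ≤ risingBinom d x) ∧
      (∀ x : ℝ, 0 < x → codim d W < risingBinom d (x + 1) →
        codim d (adjoinForm W c d) < risingBinom d x) := by
  induction d generalizing W with
  | zero =>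
    refine Filter.Eventually.of_forall fun c => ⟨fun x _ h => h, fun x _ h => h⟩
  | succ d ihd =>
    induction hn : codim (d + 1) W using Nat.strong_induction_on generalizing W with
    | _ n ihn =>
    subst hn
    by_cases h0 : codim (d + 1) W = 0
    · refine Filter.Eventually.of_forall fun c => ?_
      have h1 : codim (d + 1) (adjoinForm W c (d + 1)) = 0 := by
        have := codim_succ_eq W d c
        omega
      rw [h1, Nat.cast_zero]
      exact ⟨fun x hx _ => risingBinom_nonneg _ hx, fun x hx _ => risingBinom_pos _ hx⟩
    have hmin := eventually_forall_codim_adjoinForm_le W (d + 1)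
    filter_upwards [hmin, eventually_codim_adjoinForm_lt h0] with c hc hlt
    obtain ⟨c', hc', hI, hC⟩ :=
      (hmin.and ((ihn _ hlt (adjoinForm W c (d + 1)) rfl).and (ihd (colonForm W c)))).exists
    have e1 := codim_succ_eq W d c
    have e2 := codim_succ_eq (adjoinForm W c' (d + 1)) d c
    have e3 := codim_anti (inf_le_right.trans (adjoinForm_colonForm_le W c c' d) :
      forms k r d ⊓ _ ≤ _)
    rw [adjoinForm_comm] at e2
    have e4 := hc c'
    have e5 : (codim (d + 1) (adjoinForm W c (d + 1)) : ℝ) ≤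
        codim (d + 1) (adjoinForm (adjoinForm W c (d + 1)) c' (d + 1)) +
        codim d (adjoinForm (colonForm W c) c' d) := by
      exact_mod_cast (by omega)
    have e1' : (codim (d + 1) W : ℝ) =
        codim (d + 1) (adjoinForm W c (d + 1)) + codim d (colonForm W c) := by exact_mod_cast e1
    have key : ∀ x : ℝ, 0 ≤ x → 0 < codim (d + 1) (adjoinForm W c (d + 1)) →
        risingBinom (d + 1) x ≤ codim (d + 1) (adjoinForm W c (d + 1)) →
        ¬ (codim d (colonForm W c) : ℝ) < risingBinom d (x + 1) := by
      intro x hx hpos hxa hlt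
      obtain ⟨y, hy, hya⟩ := exists_risingBinom_eq d
        (a := codim (d + 1) (adjoinForm W c (d + 1))) (by exact_mod_cast hpos)
      have hxy : x ≤ y := by
        by_contra! hyx
        have := risingBinom_strictMono d (by linarith) hyx
        linarith
      have h1 := hC.2 y (by linarith)
        (hlt.trans_le (risingBinom_mono d (by linarith) (by linarith)))
      have h2 := hI.1 (y - 1) (by linarith) (by rw [sub_add_cancel, hya])
      have h3 := risingBinom_pascal d (y - 1)
      rw [sub_add_cancel] at h3
      linarith
    refine ⟨fun x hx hW => ?_, fun x hx hW => ?_⟩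
    · by_contra! hcon
      refine key x hx ?_ hcon.le ?_
      · exact_mod_cast (risingBinom_nonneg _ hx).trans_lt hcon
      · rw [risingBinom_pascal] at hW
        linarith
    · by_contra! hcon
      refine key x hx.le ?_ hcon ?_
      · exact_mod_cast (risingBinom_pos _ hx).trans_le hcon
      · rw [risingBinom_pascal] at hW
        linarith

end Green

section Linear

variable {k : Type*} [Field k] {r : ℕ}

/-- The degree `d + 1` part of the ideal generated by a space of linear forms. -/
noncomputable def linearIdeal (U : Submodule k (Fin r → k)) (d : ℕ) :
    Submodule k (MvPolynomial (Fin r) k) :=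
  U.map (linFormHom k r) * forms k r d

lemma linearIdeal_le {U : Submodule k (Fin r → k)} {d : ℕ}
    {W : Submodule k (MvPolynomial (Fin r) k)}
    (h : ∀ u ∈ U, ∀ f ∈ forms k r d, linForm u * f ∈ W) : linearIdeal U d ≤ W := by
  rw [linearIdeal, Submodule.mul_le]
  rintro _ ⟨u, hu, rfl⟩ f hf
  exact h u hu f hf

lemma linForm_mul_mem_linearIdeal {U : Submodule k (Fin r → k)} {d : ℕ} {u : Fin r → k}
    (hu : u ∈ U) {f : MvPolynomial (Fin r) k} (hf : f ∈ forms k r d) :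
    linForm u * f ∈ linearIdeal U d :=
  Submodule.mul_mem_mul ⟨u, hu, rfl⟩ hf

lemma adjoinForm_linearIdeal (U : Submodule k (Fin r → k)) (c : Fin r → k) (d : ℕ) :
    adjoinForm (linearIdeal U d) c (d + 1) = linearIdeal (U ⊔ Submodule.span k {c}) d := by
  rw [adjoinForm, linearIdeal, linearIdeal, Submodule.map_sup, Submodule.sup_mul,
    Submodule.map_span, Set.image_singleton]
  congr 1
  ext f
  simp [Submodule.mem_span_singleton_mul]

lemma linearIdeal_le_colonForm (U : Submodule k (Fin r → k)) (c : Fin r → k) (d : ℕ) :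
    linearIdeal U d ≤ colonForm (linearIdeal U (d + 1)) c := by
  refine linearIdeal_le fun u hu f hf => ?_
  rw [mem_colonForm, mul_left_comm]
  exact linForm_mul_mem_linearIdeal hu (linForm_mul_mem c hf)

lemma finrank_quotient_sup_span_singleton {V : Type*} [AddCommGroup V] [Module k V]
    [FiniteDimensional k V] {U : Submodule k V} {c : V} (hc : c ∉ U) :
    Module.finrank k (V ⧸ (U ⊔ Submodule.span k {c})) + 1 = Module.finrank k (V ⧸ U) := by
  have h1 := Submodule.finrank_quotient_add_finrank U
  have h2 := Submodule.finrank_quotient_add_finrank (U ⊔ Submodule.span k {c})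
  have h3 := Submodule.finrank_sup_add_finrank_inf_eq U (Submodule.span k {c})
  rw [finrank_span_singleton (show c ≠ 0 by rintro rfl; exact hc U.zero_mem),
    (Submodule.disjoint_span_singleton_of_notMem hc).eq_bot, finrank_bot] at h3
  omega

lemma codim_linearIdeal_le_of_colonForm {d : ℕ}
    (h : ∀ (U : Submodule k (Fin r → k)) (c : Fin r → k),
      (codim d (colonForm (linearIdeal U d) c) : ℝ) ≤
        risingBinom d (Module.finrank k ((Fin r → k) ⧸ U))) (U : Submodule k (Fin r → k)) :
    (codim (d + 1) (linearIdeal U d) : ℝ) ≤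
      risingBinom (d + 1) (Module.finrank k ((Fin r → k) ⧸ U)) := by
  induction hn : Module.finrank k ((Fin r → k) ⧸ U) generalizing U with
  | zero =>
    rw [Module.finrank_zero_iff, Submodule.Quotient.subsingleton_iff] at hn
    rw [codim_eq_zero (forms_succ_le fun c f hf => linForm_mul_mem_linearIdeal (by simp [hn]) hf),
      Nat.cast_zero]
    exact risingBinom_nonneg _ le_rfl
  | succ n ihn =>
    obtain ⟨c, hc⟩ : ∃ c, c ∉ U := by
      by_contra! hcon
      have : U = ⊤ := eq_top_iff.2 fun c _ => hcon c
      rw [← Submodule.Quotient.subsingleton_iff, ← Module.finrank_zero_iff (R := k)] at this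
      omega
    have h1 := ihn (U ⊔ Submodule.span k {c})
      (by have := finrank_quotient_sup_span_singleton hc; omega)
    have h2 := h U c
    rw [hn, Nat.cast_succ] at h2
    rw [codim_succ_eq _ _ c, adjoinForm_linearIdeal, Nat.cast_add, Nat.cast_succ,
      risingBinom_pascal]
    exact add_le_add h1 h2

lemma codim_linearIdeal_le (d : ℕ) (U : Submodule k (Fin r → k)) :
    (codim (d + 1) (linearIdeal U d) : ℝ) ≤
      risingBinom (d + 1) (Module.finrank k ((Fin r → k) ⧸ U)) := by
  induction d generalizing U with
  | zero =>
    exact codim_linearIdeal_le_of_colonForm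
      (fun U c => by simpa [risingBinom] using codim_zero_le _) U
  | succ d ihd =>
    refine codim_linearIdeal_le_of_colonForm (fun U c => le_trans ?_ (ihd U)) U
    exact_mod_cast codim_anti (inf_le_right.trans (linearIdeal_le_colonForm U c d))

/-- If multiplication by `u` sends all forms to the ideal of a linear space, `u` vanishes there. -/
lemma mem_of_forall_linForm_mul_mem_linearIdeal {U : Submodule k (Fin r → k)} {d : ℕ}
    {u : Fin r → k} (h : ∀ f ∈ forms k r d, linForm u * f ∈ linearIdeal U d) : u ∈ U := by
  by_contra hu
  obtain ⟨g, hgu, hg⟩ := Submodule.exists_le_ker_of_notMem hu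
  set p : Fin r → k := fun i => g (Pi.single i 1)
  have hev : ∀ c, eval p (linForm c) = g c := by
    intro c
    conv_rhs => rw [LinearMap.pi_apply_eq_sum_univ g c]
    simp only [linForm, map_sum, map_mul, eval_C, eval_X, smul_eq_mul]
    refine Finset.sum_congr rfl fun i _ => ?_
    congr 1
    refine congrArg g ?_
    ext j; simp [Pi.single_apply, eq_comm]
  have hle : linearIdeal U d ≤ LinearMap.ker (aeval p).toLinearMap :=
    linearIdeal_le fun v hv f _ => by
      rw [LinearMap.mem_ker, AlgHom.toLinearMap_apply, map_mul, aeval_eq_eval]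
      simp [hev, LinearMap.mem_ker.1 (hg hv)]
  have h1 := hle (h (linForm u ^ d) (by
    simpa using ((mem_homogeneousSubmodule _ _).1 (linForm_mem u)).pow d))
  rw [LinearMap.mem_ker, AlgHom.toLinearMap_apply, map_mul, map_pow, aeval_eq_eval] at h1
  simp [hev] at h1
  rcases h1 with h1 | h1
  · exact hgu h1
  · exact hgu h1.1

end Linear

section Multipliers

variable {k : Type*} [Field k] {r : ℕ}

/-- The linear forms whose product with every form of degree `d` lies in `W`. -/
noncomputable def multipliers (d : ℕ) (W : Submodule k (MvPolynomial (Fin r) k)) :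
    Submodule k (Fin r → k) :=
  ⨅ f : forms k r d, (W.comap (LinearMap.mulRight k (f : MvPolynomial (Fin r) k))).comap
    (linFormHom k r)

lemma mem_multipliers {d : ℕ} {W : Submodule k (MvPolynomial (Fin r) k)} {u : Fin r → k} :
    u ∈ multipliers d W ↔ ∀ f ∈ forms k r d, linForm u * f ∈ W := by
  simp [multipliers]

lemma finrank_quotient_multipliers_zero (W : Submodule k (MvPolynomial (Fin r) k)) :
    Module.finrank k ((Fin r → k) ⧸ multipliers 0 W) = codim 1 W := by
  have hker : multipliers 0 W = LinearMap.ker (W.mkQ ∘ₗ linFormHom k r) := by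
    ext u
    rw [mem_multipliers, LinearMap.mem_ker, LinearMap.comp_apply, linFormHom_apply,
      Submodule.mkQ_apply, Submodule.Quotient.mk_eq_zero]
    refine ⟨fun h => by simpa using h 1 (isHomogeneous_one _ _), fun h f hf => ?_⟩
    rw [forms, homogeneousSubmodule_zero, Submodule.mem_one] at hf
    obtain ⟨a, rfl⟩ := hf
    rw [mul_comm, ← Algebra.smul_def]
    exact W.smul_mem a h
  rw [hker, (LinearMap.quotKerEquivRange _).finrank_eq, LinearMap.range_comp, range_linFormHom]
  have h1 := Submodule.finrank_map_add_finrank_inf_ker W.mkQ (forms k r 1)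
  rw [Submodule.ker_mkQ] at h1
  have h2 := codim_add 1 W
  omega

/-- In characteristic different from two, general squares of linear forms do not vanish. -/
lemma eventually_notMem_multipliers_colonForm (hchar : (2 : k) ≠ 0) {d : ℕ}
    {W : Submodule k (MvPolynomial (Fin r) k)} (hW : codim (d + 1 + 1) W ≠ 0) :
    ∀ᶠ c in zariskiGeneric k r, c ∉ multipliers d (colonForm W c) := by
  obtain ⟨c₀, f, hf, hfW⟩ :
      ∃ c : Fin r → k, ∃ f ∈ forms k r d, linForm c * (linForm c * f) ∉ W := by
    by_contra! hcon
    refine hW (codim_eq_zero (forms_succ_le fun c => ?_))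
    suffices forms k r (d + 1) ≤ colonForm W c from this
    refine forms_succ_le fun e f hf => ?_
    rw [mem_colonForm]
    have h := W.sub_mem (W.sub_mem (hcon (c + e) f hf) (hcon c f hf)) (hcon e f hf)
    have h2 : linForm (c + e) * (linForm (c + e) * f) - linForm c * (linForm c * f) -
        linForm e * (linForm e * f) = (2 : k) • (linForm c * (linForm e * f)) := by
      rw [← linFormHom_apply (c + e), map_add, linFormHom_apply, linFormHom_apply,
        ofNat_smul_eq_nsmul, nsmul_eq_mul]
      push_cast
      ring
    rw [h2] at h
    exact (W.smul_mem_iff hchar).1 h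
  obtain ⟨g, hg, hgW⟩ := Submodule.exists_le_ker_of_notMem hfW
  choose P hP using fun i : Fin r => linForm_dual_eval
    (g ∘ₗ LinearMap.mulLeft k (X i) ∘ₗ LinearMap.mulRight k f ∘ₗ linFormHom k r)
  have hQ : ∀ c, eval c (∑ i, X i * P i) = g (linForm c * (linForm c * f)) := by
    intro c
    simp only [map_sum, map_mul, eval_X, ← hP]
    conv_rhs => rw [linForm, Finset.sum_mul, map_sum]
    refine Finset.sum_congr rfl fun i _ => ?_
    rw [mul_assoc, ← smul_eq_C_mul, map_smul, smul_eq_mul]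
    rfl
  refine eventually_zariskiGeneric_of_eval_ne_zero (∑ i, X i * P i) (c₀ := c₀)
    (by rwa [hQ]) fun c hc hcU => hc ?_
  rw [hQ]
  exact hgW (mem_multipliers.1 hcU f hf)

/-- The equality case of Green's theorem: the linear forms multiplying all forms of degree `d`
into `W` cut out a linear space of dimension at most `m`. -/
theorem finrank_quotient_multipliers_le [Infinite k] (hchar : (2 : k) ≠ 0) {m : ℕ} (hm : 1 ≤ m)
    (d : ℕ) (W : Submodule k (MvPolynomial (Fin r) k))
    (hW : (codim (d + 1) W : ℝ) = risingBinom (d + 1) (m + 1))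
    (hsec : ∀ᶠ c in zariskiGeneric k r,
      (codim (d + 1) (adjoinForm W c (d + 1)) : ℝ) = risingBinom (d + 1) m) :
    Module.finrank k ((Fin r → k) ⧸ multipliers d W) ≤ m + 1 := by
  have hm' : (1 : ℝ) ≤ m := by exact_mod_cast hm
  induction d generalizing W with
  | zero =>
    rw [finrank_quotient_multipliers_zero]
    rw [zero_add, risingBinom_one_left] at hW
    exact_mod_cast hW.le
  | succ d ih =>
    set S : Set (Fin r → k) :=
      {c | (codim (d + 1 + 1) (adjoinForm W c (d + 1 + 1)) : ℝ) = risingBinom (d + 1 + 1) m}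
    set U : (Fin r → k) → Submodule k (Fin r → k) := fun c => multipliers d (colonForm W c)
    have hcolon : ∀ c ∈ S, (codim (d + 1) (colonForm W c) : ℝ) = risingBinom (d + 1) (m + 1) := by
      intro c hc
      have h1 : (codim (d + 1 + 1) W : ℝ) = codim (d + 1 + 1) (adjoinForm W c (d + 1 + 1)) +
          codim (d + 1) (colonForm W c) := by exact_mod_cast codim_succ_eq W (d + 1) c
      have h2 := risingBinom_pascal (d + 1) m
      have h3 : (codim (d + 1 + 1) (adjoinForm W c (d + 1 + 1)) : ℝ) = risingBinom (d + 1 + 1) m := hc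
      have h4 : (codim (d + 1 + 1) W : ℝ) = risingBinom (d + 1 + 1) (m + 1) := hW
      linarith
    have hrestrict : ∀ c ∈ S, ∀ᶠ c' in zariskiGeneric k r,
        (codim (d + 1) (adjoinForm (colonForm W c) c' (d + 1)) : ℝ) = risingBinom (d + 1) m ∧
        forms k r (d + 1) ⊓ colonForm (adjoinForm W c' (d + 1 + 1)) c ≤
          adjoinForm (colonForm W c) c' (d + 1) := by
      intro c hc
      filter_upwards [hsec,
        eventually_codim_adjoinForm_le_risingBinom (d + 1) (colonForm W c),
        eventually_codim_adjoinForm_le_risingBinom (d + 1 + 1) (adjoinForm W c (d + 1 + 1))]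
        with c' hc' h1 h2
      have i1 := h1.1 m (by linarith) (hcolon c hc).le
      have i2 := h2.1 (m - 1) (by linarith) (by rw [sub_add_cancel]; exact hc.le)
      have e1 : (codim (d + 1 + 1) (adjoinForm W c' (d + 1 + 1)) : ℝ) =
          codim (d + 1 + 1) (adjoinForm (adjoinForm W c (d + 1 + 1)) c' (d + 1 + 1)) +
          codim (d + 1) (colonForm (adjoinForm W c' (d + 1 + 1)) c) := by
        rw [adjoinForm_comm]
        exact_mod_cast codim_succ_eq (adjoinForm W c' (d + 1 + 1)) (d + 1) c
      have hle : forms k r (d + 1) ⊓ adjoinForm (colonForm W c) c' (d + 1) ≤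
          colonForm (adjoinForm W c' (d + 1 + 1)) c :=
        inf_le_right.trans (adjoinForm_colonForm_le W c c' (d + 1))
      have e2 : (codim (d + 1) (colonForm (adjoinForm W c' (d + 1 + 1)) c) : ℝ) ≤
          codim (d + 1) (adjoinForm (colonForm W c) c' (d + 1)) := by
        exact_mod_cast codim_anti hle
      have e3 := risingBinom_pascal (d + 1) (m - 1)
      rw [sub_add_cancel] at e3
      have e4 : (codim (d + 1 + 1) (adjoinForm W c' (d + 1 + 1)) : ℝ) = risingBinom (d + 1 + 1) m := hc'
      have e5 : risingBinom (d + 1 + 1) m = risingBinom (d + 1 + 1) (m - 1) + risingBinom (d + 1) m := e3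
      refine ⟨by linarith, inf_le_of_codim_le hle ?_⟩
      have : (codim (d + 1) (adjoinForm (colonForm W c) c' (d + 1)) : ℝ) ≤
          codim (d + 1) (colonForm (adjoinForm W c' (d + 1 + 1)) c) := by linarith
      exact_mod_cast this
    have hlinear : ∀ c ∈ S, Module.finrank k ((Fin r → k) ⧸ U c) = m + 1 ∧
        forms k r (d + 1) ⊓ colonForm W c ≤ linearIdeal (U c) d := by
      intro c hc
      have hle : Module.finrank k ((Fin r → k) ⧸ U c) ≤ m + 1 :=
        ih (colonForm W c) (hcolon c hc) ((hrestrict c hc).mono fun _ h => h.1)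
      have hUle : linearIdeal (U c) d ≤ colonForm W c := linearIdeal_le fun u hu =>
        mem_multipliers.1 hu
      have h1 : (codim (d + 1) (colonForm W c) : ℝ) ≤ codim (d + 1) (linearIdeal (U c) d) := by
        exact_mod_cast codim_anti (inf_le_right.trans hUle)
      have h2 := codim_linearIdeal_le d (U c)
      have heq : Module.finrank k ((Fin r → k) ⧸ U c) = m + 1 := by
        refine le_antisymm hle ?_
        by_contra! hlt
        have h3 := risingBinom_strictMono d
          (Nat.cast_nonneg (Module.finrank k ((Fin r → k) ⧸ U c))) (Nat.cast_lt (α := ℝ).2 hlt)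
        rw [Nat.cast_succ] at h3
        have := hcolon c hc
        linarith
      refine ⟨heq, inf_le_of_codim_le (inf_le_right.trans hUle) ?_⟩
      rw [heq, Nat.cast_succ, ← hcolon c hc] at h2
      exact_mod_cast h2
    have hne_top : ∀ c ∈ S, ∀ u, U c ⊔ Submodule.span k {u} ≠ ⊤ := by
      intro c hc u htop
      have h1 := (hlinear c hc).1
      have h2 := Submodule.finrank_quotient_add_finrank (U c)
      have h3 := Submodule.finrank_add_le_finrank_add_finrank (U c) (Submodule.span k {u})
      have h4 : Module.finrank k (Submodule.span k {u}) ≤ 1 :=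
        (finrank_span_le_card _).trans (by simp)
      rw [htop, finrank_top] at h3
      omega
    have hWne : codim (d + 1 + 1) W ≠ 0 := by
      intro h0
      have h1 : (codim (d + 1 + 1) W : ℝ) = risingBinom (d + 1 + 1) (m + 1) := hW
      have := risingBinom_pos (d + 1 + 1) (x := m + 1) (by linarith)
      rw [h0, Nat.cast_zero] at h1
      linarith
    have hsup : ∀ c ∈ S, ∀ᶠ c' in zariskiGeneric k r,
        U c' ⊔ Submodule.span k {c'} = U c ⊔ Submodule.span k {c'} := by
      intro c hc
      have hUc : U c ≠ ⊤ := fun h => hne_top c hc 0 (by simp [h])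
      filter_upwards [hsec, eventually_forall_codim_adjoinForm_le W (d + 1 + 1),
        eventually_notMem_multipliers_colonForm hchar hWne, hrestrict c hc,
        Submodule.eventually_notMem hUc] with c' hc' hmin hsq hres hmem
      have hle : U c' ⊔ Submodule.span k {c'} ≤ U c ⊔ Submodule.span k {c'} := by
        refine sup_le (fun u hu => ?_) le_sup_right
        apply mem_of_forall_linForm_mul_mem_linearIdeal (d := d)
        intro g hg
        have hug : linForm u * g ∈ forms k r (d + 1) := linForm_mul_mem u hg
        have h1 : linForm u * g ∈ adjoinForm (colonForm W c) c' (d + 1) :=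
          hres.2 (Submodule.mem_inf.2 ⟨hug, mem_colonForm.2
            (linForm_mul_mem_adjoinForm_of_forall_codim_le hmin hug
              (mem_colonForm.1 (mem_multipliers.1 hu g hg)) c)⟩)
        rw [← adjoinForm_linearIdeal]
        obtain ⟨a, ha, _, ⟨b, hb, rfl⟩, hab⟩ := Submodule.mem_sup.1 h1
        rw [← hab]
        refine add_mem (le_adjoinForm _ _ _ ((hlinear c hc).2
          (Submodule.mem_inf.2 ⟨?_, ha⟩))) (linForm_mul_mem_adjoinForm _ _ hb)
        rw [eq_sub_of_add_eq hab, LinearMap.mulLeft_apply]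
        exact sub_mem hug (linForm_mul_mem c' hb)
      refine Submodule.eq_of_le_of_finrank_le hle ?_
      have h1 := finrank_quotient_sup_span_singleton (U := U c') hsq
      have h2 := finrank_quotient_sup_span_singleton hmem
      have h3 := (hlinear c hc).1
      have h4 := (hlinear c' hc').1
      have h5 := Submodule.finrank_quotient_add_finrank (U c ⊔ Submodule.span k {c'})
      have h6 := Submodule.finrank_quotient_add_finrank (U c' ⊔ Submodule.span k {c'})
      omega
    have hUle : ∀ c₁ ∈ S, ∀ c₂ ∈ S, U c₁ ≤ U c₂ := by
      intro c₁ h₁ c₂ h₂ u hu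
      by_contra hu₂
      refine hne_top c₂ h₂ u (Submodule.eq_top_of_eventually_zariskiGeneric ?_)
      filter_upwards [hsup c₁ h₁, hsup c₂ h₂] with c' e₁ e₂
      have hmem : u ∈ U c₂ ⊔ Submodule.span k {c'} := by
        rw [← e₂, e₁]
        exact Submodule.mem_sup_left hu
      obtain ⟨a, ha, b, hb, hab⟩ := Submodule.mem_sup.1 hmem
      obtain ⟨t, rfl⟩ := Submodule.mem_span_singleton.1 hb
      have ht : t ≠ 0 := by
        rintro rfl
        rw [zero_smul, add_zero] at hab
        exact hu₂ (hab ▸ ha)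
      rw [← Submodule.smul_mem_iff _ ht, eq_sub_of_add_eq' hab]
      exact sub_mem (Submodule.mem_sup_right (Submodule.mem_span_singleton_self u))
        (Submodule.mem_sup_left ha)
    obtain ⟨c₁, h₁⟩ := hsec.exists
    have hfinal : U c₁ ≤ multipliers (d + 1) W := by
      intro u hu
      rw [mem_multipliers]
      suffices forms k r (d + 1) ≤ colonForm W u from this
      refine forms_succ_le fun c f hf => ?_
      have htop : ((W.comap (LinearMap.mulRight k (linForm u * f))).comap (linFormHom k r)) = ⊤ :=
        Submodule.eq_top_of_eventually_zariskiGeneric (hsec.mono fun c hc => by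
          have h := mem_multipliers.1 (hUle c₁ h₁ c hc hu) f hf
          rw [mem_colonForm] at h
          exact h)
      rw [mem_colonForm, mul_left_comm]
      exact htop.ge (Submodule.mem_top (x := c))
    have h1 := Submodule.finrank_mono hfinal
    have h2 := Submodule.finrank_quotient_add_finrank (U c₁)
    have h3 := Submodule.finrank_quotient_add_finrank (multipliers (d + 1) W)
    have h4 := (hlinear c₁ h₁).1
    omega

end Multipliers

section HilbertFunction

variable {k : Type*} [Field k] {r : ℕ}

lemma hilb_eq_codim (I : Ideal (MvPolynomial (Fin r) k)) (d : ℕ) :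
    hilb k r I d = codim d (I.restrictScalars k) := by
  have h := Submodule.finrank_map_add_finrank_inf_ker (Ideal.Quotient.mkₐ k I).toLinearMap
    (forms k r d)
  have hker : LinearMap.ker (Ideal.Quotient.mkₐ k I).toLinearMap = I.restrictScalars k := by
    ext f
    simp [Ideal.Quotient.eq_zero_iff_mem]
  rw [hker] at h
  have := codim_add d (I.restrictScalars k)
  have : hilb k r I d =
    Module.finrank k ((forms k r d).map (Ideal.Quotient.mkₐ k I).toLinearMap) := rfl
  omega

lemma finrank_forms (m d : ℕ) :
    Module.finrank k (forms k (m + 1) d) = Nat.choose (m + d) d := by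
  rw [forms, homogeneousSubmodule_eq_finsupp_supported,
    (AddMonoidAlgebra.supportedEquivFinsupp (R := k) (S := k) _).finrank_eq,
    Module.finrank_eq_nat_card_basis Finsupp.basisSingleOne]
  have h : {x : Fin (m + 1) →₀ ℕ | x.degree = d} =
      (Finset.univ.finsuppAntidiag d : Finset (Fin (m + 1) →₀ ℕ)) := by
    ext x
    simp [Finsupp.degree_eq_sum]
  rw [h, Nat.card_coe_set_eq, Set.ncard_coe_finset, Finset.card_finsuppAntidiag_nat_eq_choose,
    Finset.card_univ, Fintype.card_fin, add_right_comm, Nat.add_sub_cancel]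

lemma homogeneousComponent_succ_linForm_mul (c : Fin r → k) (d : ℕ)
    (f : MvPolynomial (Fin r) k) :
    homogeneousComponent (d + 1) (linForm c * f) = linForm c * homogeneousComponent d f := by
  conv_lhs => rw [← sum_homogeneousComponent f, Finset.mul_sum, map_sum]
  have h : ∀ i, homogeneousComponent (d + 1) (linForm c * homogeneousComponent i f) =
      linForm c * homogeneousComponent d (homogeneousComponent i f) := fun i => by
    rw [homogeneousComponent_of_mem (linForm_mul_mem c (homogeneousComponent_mem i f)),
      homogeneousComponent_of_mem (homogeneousComponent_mem i f)]
    simp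
  simp_rw [h]
  rw [← Finset.mul_sum, ← map_sum, sum_homogeneousComponent]

lemma hilb_sup_span_linForm {I : Ideal (MvPolynomial (Fin r) k)} (hI : IsHomogIdeal I)
    (c : Fin r → k) (d : ℕ) :
    hilb k r (I ⊔ Ideal.span {linForm c}) (d + 1) =
      codim (d + 1) (adjoinForm (I.restrictScalars k) c (d + 1)) := by
  rw [hilb_eq_codim]
  apply le_antisymm
  · refine codim_anti (inf_le_right.trans (sup_le (fun f hf => ?_) ?_))
    · exact Submodule.mem_sup_left (S := I) hf
    · rintro _ ⟨f, -, rfl⟩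
      exact Submodule.mem_sup_right (S := I)
        (Ideal.mul_mem_right f _ (Ideal.mem_span_singleton_self _))
  · refine codim_anti fun f hf => ?_
    obtain ⟨hf, hfI⟩ := Submodule.mem_inf.1 hf
    rw [Submodule.restrictScalars_mem] at hfI
    obtain ⟨a, ha, b, hb, hab⟩ := Submodule.mem_sup.1 hfI
    obtain ⟨b, rfl⟩ := Ideal.mem_span_singleton.1 hb
    rw [← homogeneousComponent_eq_self hf, ← hab, map_add, homogeneousComponent_succ_linForm_mul]
    exact add_mem (le_adjoinForm _ _ _ (hI a ha _))
      (linForm_mul_mem_adjoinForm _ _ (homogeneousComponent_mem _ _))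

lemma mem_of_socDim_eq_zero {I : Ideal (MvPolynomial (Fin r) k)} {d : ℕ}
    (h : socDim k r I d = 0) {f : MvPolynomial (Fin r) k} (hf : f ∈ forms k r d)
    (hfX : ∀ j, X j * f ∈ I) : f ∈ I := by
  rw [socDim, Submodule.finrank_eq_zero] at h
  have hmem := h.le (Submodule.mem_map_of_mem
    (Submodule.mem_inf.2 ⟨hf, Submodule.mem_iInf _ |>.2 fun j => hfX j⟩))
  rw [Submodule.mem_bot] at hmem
  exact Ideal.Quotient.eq_zero_iff_mem.1 hmem

lemma linForm_mem_of_mem_multipliers {I : Ideal (MvPolynomial (Fin r) k)} {d : ℕ}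
    (hsoc : ∀ i ≤ d, socDim k r I i = 0) {u : Fin r → k}
    (hu : u ∈ multipliers d (I.restrictScalars k)) : linForm u ∈ I := by
  induction d with
  | zero => simpa using mem_multipliers.1 hu 1 (isHomogeneous_one _ _)
  | succ d ih =>
    refine ih (fun i hi => hsoc i (hi.trans d.le_succ)) (mem_multipliers.2 fun f hf => ?_)
    refine mem_of_socDim_eq_zero (hsoc (d + 1) le_rfl) (linForm_mul_mem u hf) fun j => ?_
    rw [mul_left_comm, ← linForm_single]
    exact mem_multipliers.1 hu _ (linForm_mul_mem _ hf)

lemma linForm_eq_zero_iff {u : Fin r → k} : linForm u = 0 ↔ u = 0 := by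
  refine ⟨fun h => funext fun i => ?_, by rintro rfl; simp [linForm]⟩
  simpa [linForm, Pi.single_apply] using congrArg (eval (Pi.single i 1)) h

lemma forms_inf_eq_bot_of_le {I : Ideal (MvPolynomial (Fin (r + 1)) k)} {i d : ℕ} (hid : i ≤ d)
    (h : forms k (r + 1) d ⊓ I.restrictScalars k = ⊥) :
    forms k (r + 1) i ⊓ I.restrictScalars k = ⊥ := by
  refine (Submodule.eq_bot_iff _).2 fun f hf => ?_
  obtain ⟨hf, hfI⟩ := Submodule.mem_inf.1 hf
  have h1 : X 0 ^ (d - i) * f ∈ forms k (r + 1) d := by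
    have := (isHomogeneous_X_pow (R := k) (0 : Fin (r + 1)) (d - i)).mul
      ((mem_homogeneousSubmodule _ _).1 hf)
    rwa [Nat.sub_add_cancel hid] at this
  have h2 := h.le (Submodule.mem_inf.2 ⟨h1, I.mul_mem_left _ hfI⟩)
  exact (mul_eq_zero.1 ((Submodule.mem_bot k).1 h2)).resolve_left (pow_ne_zero _ (X_ne_zero _))

end HilbertFunction

/-- Proposition 2.5: under the hypotheses of Green's Theorem 3, if the socle of
`A = R/I` vanishes in all degrees `≤ d-1`, then `h_i = C(m+i, i)` for all
`0 ≤ i ≤ d`. -/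
theorem hilbert_determined_up_to_d
    (k : Type*) [Field k] [Infinite k] (hchar : (2 : k) ≠ 0)
    (r d m : ℕ) (hd : 1 ≤ d) (hm : 1 ≤ m) (hmr : m ≤ r - 1)
    (I : Ideal (MvPolynomial (Fin r) k)) (hI : IsHomogIdeal I)
    (hlin : NoLinearForms I)
    (hsoc : ∀ i : ℕ, i ≤ d - 1 → socDim k r I i = 0)
    (hhd : hilb k r I d = Nat.choose (m + d) d)
    (hgen : Generically k r (fun L =>
      hilb k r (I ⊔ Ideal.span {L}) d = Nat.choose (m - 1 + d) d)) :
    ∀ i : ℕ, i ≤ d → hilb k r I i = Nat.choose (m + i) i := by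
  intro i hi
  obtain ⟨D, rfl⟩ := Nat.exists_eq_add_of_le' hd
  have hW : (codim (D + 1) (I.restrictScalars k) : ℝ) = risingBinom (D + 1) (m + 1) := by
    rw [risingBinom_natCast_add_one, ← hhd, hilb_eq_codim]
  have hsec : ∀ᶠ c in zariskiGeneric k r,
      (codim (D + 1) (adjoinForm (I.restrictScalars k) c (D + 1)) : ℝ) =
        risingBinom (D + 1) m := by
    filter_upwards [eventually_zariskiGeneric.2 hgen] with c hc
    rw [← hilb_sup_span_linForm hI, hc, ← risingBinom_natCast_add_one, Nat.cast_sub hm,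
      Nat.cast_one, sub_add_cancel]
  have hbot : multipliers D (I.restrictScalars k) = ⊥ := by
    refine (Submodule.eq_bot_iff _).2 fun u hu => linForm_eq_zero_iff.1 ?_
    exact hlin _ (linForm_mem_of_mem_multipliers hsoc hu) (linForm_mem u)
  have hrank := finrank_quotient_multipliers_le hchar hm D _ hW hsec
  have hadd := Submodule.finrank_quotient_add_finrank (multipliers D (I.restrictScalars k))
  rw [hbot, finrank_bot, Module.finrank_fin_fun, ← hbot] at hadd
  obtain rfl : r = m + 1 := by omega
  have htop : forms k (m + 1) (D + 1) ⊓ I.restrictScalars k = ⊥ := by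
    rw [← Submodule.finrank_eq_zero (R := k)]
    have h := codim_add (D + 1) (I.restrictScalars k)
    rw [finrank_forms, ← hilb_eq_codim, hhd] at h
    omega
  rw [hilb_eq_codim, codim, forms_inf_eq_bot_of_le hi htop, finrank_bot, finrank_forms,
    Nat.sub_zero]
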